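/- Let k be a field of characteristic zero, d ≥ 1, and let X, Y be nilpotent d×d matrices over k such that Z := X*Y − Y*X satisfies X*Z = Z*X and Y*Z = Z*Y. For x, y, z ∈ k define M(x,y,z) := exp( x • X + y • Y + (z − x*y/2) • Z ), where for a d×d matrix N we set exp(N) := Σ_{j=0}^{d−1} ((j! : k))⁻¹ • N^j. Then M(0,0,0) = 1 and M(x,y,z) * M(r,s,t) = M(x+r, y+s, z + x*s + t) for all x, y, z, r, s, t ∈ k; that is, M is a d-dimensional representation of the Heisenberg group H₁(k). -/

import Mathlib

/-- The truncated exponential `exp(N) = ∑_{j=0}^{d-1} (j!)⁻¹ • N^j` of a `d × d` matrix. -/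
noncomputable def texp {k : Type*} [Field k] {d : ℕ} (N : Matrix (Fin d) (Fin d) k) :
    Matrix (Fin d) (Fin d) k :=
  ∑ j ∈ Finset.range d, ((j.factorial : k))⁻¹ • N ^ j

/-- `M(x,y,z) = exp(x • X + y • Y + (z - x*y/2) • Z)` where `Z := X*Y - Y*X`. -/
noncomputable def heisM {k : Type*} [Field k] {d : ℕ}
    (X Y : Matrix (Fin d) (Fin d) k) (x y z : k) : Matrix (Fin d) (Fin d) k :=
  texp (x • X + y • Y + (z - x * y / 2) • (X * Y - Y * X))

section BakerCampbellHausdorff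

open Polynomial

variable {A : Type*} [Ring A]

theorem leibniz_pow_succ_of_commute (D : A →+ A)
    (hD : ∀ x y, D (x * y) = D x * y + x * D y) {u : A} (hu : Commute u (D u)) (n : ℕ) :
    D (u ^ (n + 1)) = (n + 1) • (D u * u ^ n) := by
  induction n with
  | zero => simp
  | succ n ih =>
    rw [pow_succ, hD, ih, (hu.pow_left (n + 1)).eq, smul_mul_assoc, mul_assoc, ← pow_succ,
      succ_nsmul _ (n + 1)]

/-- The commutator `x ↦ x * v - v * x` as an additive map. -/
def commutatorRight (v : A) : A →+ A := AddMonoidHom.mulRight v - AddMonoidHom.mulLeft v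

theorem commutatorRight_apply (v x : A) : commutatorRight v x = x * v - v * x := rfl

theorem commutatorRight_mul (v x y : A) :
    commutatorRight v (x * y) = commutatorRight v x * y + x * commutatorRight v y := by
  simp only [commutatorRight_apply]; noncomm_ring

theorem IsNilpotent.commutator [IsAddTorsionFree A] {u v : A} (hu : IsNilpotent u)
    (huw : Commute u (u * v - v * u)) (hvw : Commute v (u * v - v * u)) :
    IsNilpotent (u * v - v * u) := by
  obtain ⟨n, hn⟩ := hu
  set w := u * v - v * u with hw
  have key : ∀ m j, u ^ m * w ^ j = 0 → w ^ (j + m) = 0 := by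
    intro m
    induction m with
    | zero => intro j h; simpa using h
    | succ m ih =>
      intro j h
      have hD := congrArg (commutatorRight v) h
      have hwj : commutatorRight v (w ^ j) = 0 := by
        rw [commutatorRight_apply, (hvw.pow_right j).eq, sub_self]
      rw [commutatorRight_mul, leibniz_pow_succ_of_commute _ (commutatorRight_mul v)
        (by rwa [commutatorRight_apply]), hwj, map_zero, mul_zero, add_zero, commutatorRight_apply,
        ← hw, smul_mul_assoc, smul_eq_zero_iff_right m.succ_ne_zero, ← (huw.pow_left m).eq,
        mul_assoc, ← pow_succ'] at hD
      have := ih (j + 1) hD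
      rwa [show j + (m + 1) = j + 1 + m by omega]
  exact ⟨n, by simpa using key n 0 (by simp [hn])⟩

theorem IsNilpotent.C_mul_X_pow {a : A} (ha : IsNilpotent a) (n : ℕ) :
    IsNilpotent (C a * X ^ n) :=
  (commute_X_pow (C a) n).symm.isNilpotent_mul_right (ha.map C)

variable [Algebra ℚ A]

theorem Commute.isNilpotentExp_left {u v : A} (h : Commute u v) : Commute (IsNilpotent.exp u) v :=
  Commute.sum_left _ _ _ fun i _ ↦ (h.pow_left i).smul_left _

theorem IsNilpotent.leibniz_exp (D : A →+ A)
    (hD : ∀ x y, D (x * y) = D x * y + x * D y) {u : A} (hu : Commute u (D u))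
    (hn : IsNilpotent u) : D (exp u) = D u * exp u := by
  obtain ⟨n, hn⟩ := hn
  have hD1 : D 1 = 0 := by simpa using hD 1 1
  conv_lhs => rw [exp_eq_sum (pow_eq_zero_of_le n.le_succ hn), Finset.sum_range_succ', map_add]
  simp only [Nat.factorial_zero, pow_zero, Nat.cast_one, inv_one, one_smul, hD1, add_zero, map_sum]
  rw [exp_eq_sum hn, Finset.mul_sum]
  refine Finset.sum_congr rfl fun i _ ↦ ?_
  rw [map_rat_smul D, leibniz_pow_succ_of_commute D hD hu, ← Nat.cast_smul_eq_nsmul ℚ,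
    smul_smul, mul_smul_comm, Nat.factorial_succ]
  congr 1
  have := i.factorial_ne_zero
  push_cast
  field_simp

theorem Polynomial.coeff_eq_inv_factorial_smul_pow {w : A} {F : A[X]}
    (hF : derivative F = C w * F) (h0 : F.coeff 0 = 1) (n : ℕ) :
    F.coeff n = (n.factorial : ℚ)⁻¹ • w ^ n := by
  induction n with
  | zero => simp [h0]
  | succ n ih =>
    have h := congrArg (coeff · n) hF
    simp only [coeff_derivative, coeff_C_mul, ih] at h
    have h' : ((n : ℚ) + 1) • F.coeff (n + 1) = (n.factorial : ℚ)⁻¹ • w ^ (n + 1) := by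
      rw [pow_succ', ← mul_smul_comm, ← h, Algebra.smul_def, map_add, map_natCast, map_one]
      exact ((Nat.cast_commute n _).add_left (Commute.one_left _)).eq
    have hn : (n : ℚ) + 1 ≠ 0 := by positivity
    rw [← inv_smul_smul₀ hn (F.coeff (n + 1)), h', smul_smul, Nat.factorial_succ]
    push_cast
    rw [mul_inv]

/-- A polynomial solution of `F' = w F` with `F(0) = 1` forces `w` to be nilpotent, and its value
at `1` is `exp w`. -/
theorem Polynomial.isNilpotent_and_eval_one_eq_exp {w : A} {F : A[X]}
    (hF : derivative F = C w * F) (h0 : F.coeff 0 = 1) :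
    IsNilpotent w ∧ F.eval 1 = IsNilpotent.exp w := by
  have hc := coeff_eq_inv_factorial_smul_pow hF h0
  have hw : w ^ (F.natDegree + 1) = 0 := by
    have h := hc (F.natDegree + 1)
    rw [coeff_eq_zero_of_natDegree_lt (Nat.lt_succ_self _)] at h
    exact (smul_eq_zero_iff_right
      (inv_ne_zero (Nat.cast_ne_zero.2 (Nat.factorial_ne_zero _)))).1 h.symm
  refine ⟨⟨_, hw⟩, ?_⟩
  rw [eval_eq_sum_range, IsNilpotent.exp_eq_sum hw]
  simp [hc]

/-- Normal ordering for nilpotent elements with central commutator `a * b - b * a`. -/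
theorem IsNilpotent.add_and_exp_mul_exp_mul_exp {a b : A} (ha : IsNilpotent a)
    (hb : IsNilpotent b) (hac : Commute a (a * b - b * a)) (hbc : Commute b (a * b - b * a)) :
    IsNilpotent (a + b) ∧
      exp a * exp b * exp ((-1 / 2 : ℚ) • (a * b - b * a)) = exp (a + b) := by
  have : IsAddTorsionFree A := IsAddTorsionFree.of_module_rat A
  have hc := ha.commutator hac hbc
  set c := a * b - b * a with hcdef
  set c' := (-1 / 2 : ℚ) • c with hc'def
  have hc' : IsNilpotent c' := hc.smul _
  have ha1 := ha.C_mul_X_pow 1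
  have hb1 := hb.C_mul_X_pow 1
  have hc2 := hc'.C_mul_X_pow 2
  have hX (p : A[X]) (n : ℕ) : Commute p (X ^ n) := (commute_X_pow p n).symm
  have hexp {u : A} (hu : IsNilpotent u) (n : ℕ) :
      derivative (exp (C u * X ^ n)) = derivative (C u * X ^ n) * exp (C u * X ^ n) := by
    refine leibniz_exp derivative.toAddMonoidHom (fun x y ↦ derivative_mul) ?_ (hu.C_mul_X_pow n)
    change Commute _ (derivative (C u * X ^ n))
    rw [derivative_C_mul_X_pow]
    refine Commute.mul_right (Commute.mul_left ?_ (hX _ n).symm) (hX _ _)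
    exact ((Commute.refl u).mul_right (Nat.commute_cast u n)).map C
  have hXc {u : A} (hu : Commute u c) : Commute (C u * X ^ 1) (C c * X ^ 1) :=
    ((hu.map C).mul_left (hX _ 1).symm).mul_right (hX _ 1)
  have hexpc {u : A} (hu : Commute u c) : Commute (exp (C u * X ^ 1)) (C c * X ^ 1) :=
    (hXc hu).isNilpotentExp_left
  have hswap : exp (C a * X ^ 1) * C b = (C b + C c * X ^ 1) * exp (C a * X ^ 1) := by
    have hd : commutatorRight (C b) (C a * X ^ 1) = C c * X ^ 1 := by
      rw [commutatorRight_apply, mul_assoc, ← (hX (C b) 1).eq, ← mul_assoc, ← mul_assoc, ← sub_mul,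
        ← C_mul, ← C_mul, ← C_sub]
    have h := leibniz_exp (commutatorRight (C b)) (commutatorRight_mul (C b)) (u := C a * X ^ 1)
      (by rw [hd]; exact hXc hac) ha1
    rw [hd, commutatorRight_apply] at h
    rw [add_mul, ← h, add_sub_cancel]
  have hF : derivative (exp (C a * X ^ 1) * exp (C b * X ^ 1) * exp (C c' * X ^ 2)) =
      C (a + b) * (exp (C a * X ^ 1) * exp (C b * X ^ 1) * exp (C c' * X ^ 2)) := by
    have hd1 (u : A) : derivative (C u * X ^ 1) = C u := by simp
    have hd2 : derivative (C c' * X ^ 2) = -(C c * X ^ 1) := by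
      have : c' * 2 = -c := by
        rw [mul_two, hc'def, ← add_smul]; norm_num
      rw [derivative_C_mul_X_pow, Nat.cast_two, this, C_neg, neg_mul]
    have hcomm := ((hexpc hac).mul_left (hexpc hbc)).eq
    rw [derivative_mul, derivative_mul, hexp ha, hexp hb, hexp hc', hd1, hd1, hd2,
      ← mul_assoc _ (C b), hswap, neg_mul, mul_neg, ← mul_assoc _ (C c * X ^ 1), hcomm, C_add]
    noncomm_ring
  have h0 : (exp (C a * X ^ 1) * exp (C b * X ^ 1) * exp (C c' * X ^ 2)).coeff 0 = 1 := by
    rw [← constantCoeff_apply]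
    rw [map_mul, map_mul, map_exp ha1, map_exp hb1, map_exp hc2]
    simp
  obtain ⟨hw, h1⟩ := isNilpotent_and_eval_one_eq_exp hF h0
  refine ⟨hw, ?_⟩
  rw [← h1]
  let φ : A[X] →+* A := eval₂RingHom' (RingHom.id A) 1 fun _ ↦ Commute.one_right _
  change _ = φ _
  rw [map_mul, map_mul, map_exp ha1, map_exp hb1, map_exp hc2]
  simp [φ, eval₂RingHom']

/-- The Baker–Campbell–Hausdorff formula for nilpotent elements with central commutator. -/
theorem IsNilpotent.exp_mul_exp_of_commute_commutator {a b : A} (ha : IsNilpotent a)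
    (hb : IsNilpotent b) (hac : Commute a (a * b - b * a)) (hbc : Commute b (a * b - b * a)) :
    exp a * exp b = exp (a + b + (1 / 2 : ℚ) • (a * b - b * a)) := by
  have : IsAddTorsionFree A := IsAddTorsionFree.of_module_rat A
  have hc := ha.commutator hac hbc
  obtain ⟨hab, h⟩ := ha.add_and_exp_mul_exp_mul_exp hb hac hbc
  rw [exp_add_of_commute ((hac.add_left hbc).smul_right _) hab (hc.smul _), ← h, neg_div, neg_smul,
    mul_assoc (exp a * exp b), exp_neg_mul_exp_self (hc.smul _), mul_one]

end BakerCampbellHausdorff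

theorem Matrix.pow_card_eq_zero_of_isNilpotent {n R : Type*} [Fintype n] [DecidableEq n]
    [CommRing R] [IsDomain R] {N : Matrix n n R} (hN : IsNilpotent N) :
    N ^ Fintype.card n = 0 := by
  have h := (Matrix.isNilpotent_charpoly_sub_pow_of_isNilpotent hN).eq_zero
  simpa [sub_eq_zero.1 h] using N.aeval_self_charpoly

theorem texp_eq_exp {k : Type*} [Field k] [CharZero k] {d : ℕ} {N : Matrix (Fin d) (Fin d) k}
    (hN : IsNilpotent N) : texp N = IsNilpotent.exp N := by
  rw [IsNilpotent.exp_eq_sum (by simpa using Matrix.pow_card_eq_zero_of_isNilpotent hN), texp]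
  refine Finset.sum_congr rfl fun j _ ↦ ?_
  rw [← Rat.cast_smul_eq_qsmul k]
  simp

/-- In characteristic zero, for nilpotent `X`, `Y` whose commutator `Z := X*Y - Y*X`
commutes with `X` and `Y`, the matrices `M(x,y,z) = exp(x • X + y • Y + (z - xy/2) • Z)`
form a `d`-dimensional representation of the Heisenberg group `H₁(k)`:
`M(0,0,0) = 1` and `M(x,y,z) * M(r,s,t) = M(x+r, y+s, z + x*s + t)`. -/
theorem stmt18 (k : Type*) [Field k] [CharZero k] (d : ℕ) (hd : 1 ≤ d)
    (X Y : Matrix (Fin d) (Fin d) k) (hX : IsNilpotent X) (hY : IsNilpotent Y)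
    (hXZ : X * (X * Y - Y * X) = (X * Y - Y * X) * X)
    (hYZ : Y * (X * Y - Y * X) = (X * Y - Y * X) * Y) :
    heisM X Y 0 0 0 = 1 ∧
    ∀ x y z r s t : k,
      heisM X Y x y z * heisM X Y r s t = heisM X Y (x + r) (y + s) (z + x * s + t) := by
  set Z := X * Y - Y * X with hZ
  have hcX : Commute X Z := hXZ
  have hcY : Commute Y Z := hYZ
  have hbr (x y c r s c' : k) :
      (x • X + y • Y + c • Z) * (r • X + s • Y + c' • Z) -
        (r • X + s • Y + c' • Z) * (x • X + y • Y + c • Z) = (x * s - y * r) • Z := by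
    simp only [add_mul, mul_add, smul_mul_assoc, mul_smul_comm, hcX.eq, hcY.eq]
    rw [show X * Y = Z + Y * X by rw [hZ]; abel]
    module
  have hcZ (x y c e : k) : Commute (x • X + y • Y + c • Z) (e • Z) :=
    (((hcX.smul_left x).add_left (hcY.smul_left y)).add_left
      ((Commute.refl Z).smul_left c)).smul_right e
  have : IsAddTorsionFree (Matrix (Fin d) (Fin d) k) := IsAddTorsionFree.of_module_rat _
  have hZn : IsNilpotent Z := hX.commutator hXZ hYZ
  have hn (x y c : k) : IsNilpotent (x • X + y • Y + c • Z) := by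
    have h := hbr x 0 0 0 y 0
    simp only [zero_smul, add_zero, zero_add] at h
    have h' := ((hX.smul x).add_and_exp_mul_exp_mul_exp (hY.smul y)
      (by rw [h]; exact (hcX.smul_left _).smul_right _)
      (by rw [h]; exact (hcY.smul_left _).smul_right _)).1
    exact Commute.isNilpotent_add (((hcX.smul_left x).add_left (hcY.smul_left y)).smul_right c)
      h' (hZn.smul c)
  refine ⟨?_, fun x y z r s t ↦ ?_⟩
  · rw [heisM, texp_eq_exp (hn _ _ _)]
    simp
  · simp only [heisM]
    rw [← hZ, texp_eq_exp (hn _ _ _), texp_eq_exp (hn _ _ _), texp_eq_exp (hn _ _ _),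
      (hn _ _ _).exp_mul_exp_of_commute_commutator (hn _ _ _) (by rw [hbr]; exact hcZ _ _ _ _)
        (by rw [hbr]; exact hcZ _ _ _ _), hbr, ← Rat.cast_smul_eq_qsmul k]
    congr 1
    push_cast
    module
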